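/- arXiv:1709.04414 — 4 statements merged into one kernel-verified Lean document; each statement's English description precedes it below -/
import Mathlib

section
/- Let X be a real (or complex) Banach space, T > 0, let u : [0,T] → X be continuous, and let k : {(t,s) : 0 ≤ s ≤ t ≤ T} → B(X) be continuous in the operator norm, where B(X) denotes the bounded linear operators on X. Then there exists a unique continuous function w : [0,T] → X satisfying the Volterra integral equation w(t) = u(t) + ∫₀ᵗ k(t,s)(w(s)) ds for all t ∈ [0,T]. -/
section Volterra

variable {X : Type*} [NormedAddCommGroup X] [NormedSpace ℝ X]

theorem continuous_volterra_integrand {T : ℝ} (hT : 0 ≤ T) {K : ℝ → ℝ → X →L[ℝ] X}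
    (hK : Continuous fun p : ℝ × ℝ => K p.1 p.2) (w : C(Set.Icc 0 T, X)) :
    Continuous fun p : ℝ × ℝ => K p.1 p.2 (w (Set.projIcc 0 T hT p.2)) :=
  hK.clm_apply (w.continuous.comp (continuous_projIcc.comp continuous_snd))

/-- The affine Volterra operator `w ↦ u + ∫₀ᵗ K(t, s) (w s) ds` on `C([0, T], X)`. -/
noncomputable def volterraOperator {T : ℝ} (hT : 0 ≤ T) {K : ℝ → ℝ → X →L[ℝ] X}
    (hK : Continuous fun p : ℝ × ℝ => K p.1 p.2) (u w : C(Set.Icc 0 T, X)) :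
    C(Set.Icc 0 T, X) where
  toFun t := u t + ∫ s in (0 : ℝ)..t, K t s (w (Set.projIcc 0 T hT s))
  continuous_toFun := by
    have h := intervalIntegral.continuous_parametric_intervalIntegral_of_continuous
      (μ := MeasureTheory.volume) (a₀ := 0)
      (f := fun t s => K t s (w (Set.projIcc 0 T hT s)))
      (continuous_volterra_integrand hT hK w) continuous_id
    exact u.continuous.add (h.comp continuous_subtype_val)

theorem norm_iterate_volterraOperator_sub_le {T : ℝ} (hT : 0 ≤ T) {K : ℝ → ℝ → X →L[ℝ] X}
    (hK : Continuous fun p : ℝ × ℝ => K p.1 p.2) (u v w : C(Set.Icc 0 T, X)) {M : ℝ}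
    (hM : ∀ t ∈ Set.Icc 0 T, ∀ s ∈ Set.Icc 0 T, ‖K t s‖ ≤ M) (n : ℕ) (t : Set.Icc 0 T) :
    ‖(volterraOperator hT hK u)^[n] v t - (volterraOperator hT hK u)^[n] w t‖ ≤
      M ^ n * (t : ℝ) ^ n / n.factorial * dist v w := by
  induction n generalizing t with
  | zero => simpa [dist_eq_norm] using ContinuousMap.dist_apply_le_dist (f := v) (g := w) t
  | succ n ih =>
    have hM0 : 0 ≤ M :=
      (norm_nonneg _).trans (hM 0 (Set.left_mem_Icc.2 hT) 0 (Set.left_mem_Icc.2 hT))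
    rw [Function.iterate_succ_apply', Function.iterate_succ_apply']
    set a := (volterraOperator hT hK u)^[n] v
    set b := (volterraOperator hT hK u)^[n] w
    have hc (c : C(Set.Icc 0 T, X)) : IntervalIntegrable
        (fun s => K t s (c (Set.projIcc 0 T hT s))) MeasureTheory.volume 0 t :=
      ((continuous_volterra_integrand hT hK c).comp
        (Continuous.prodMk_right (t : ℝ))).intervalIntegrable _ _
    change ‖(u t + ∫ s in (0 : ℝ)..t, K t s (a (Set.projIcc 0 T hT s))) -
      (u t + ∫ s in (0 : ℝ)..t, K t s (b (Set.projIcc 0 T hT s)))‖ ≤ _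
    rw [add_sub_add_left_eq_sub, ← intervalIntegral.integral_sub (hc a) (hc b)]
    have hbound : ∀ s ∈ Set.Ioc (0 : ℝ) t,
        ‖K t s (a (Set.projIcc 0 T hT s)) - K t s (b (Set.projIcc 0 T hT s))‖ ≤
          M ^ (n + 1) / n.factorial * dist v w * s ^ n := by
      intro s hs
      have hs' : s ∈ Set.Icc 0 T := ⟨hs.1.le, hs.2.trans t.2.2⟩
      rw [← map_sub, Set.projIcc_of_mem hT hs']
      calc _ ≤ ‖K t s‖ * ‖a ⟨s, hs'⟩ - b ⟨s, hs'⟩‖ := (K t s).le_opNorm _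
        _ ≤ M * (M ^ n * s ^ n / n.factorial * dist v w) :=
          mul_le_mul (hM t t.2 s hs') (ih ⟨s, hs'⟩) (norm_nonneg _) hM0
        _ = _ := by ring
    refine (intervalIntegral.norm_integral_le_of_norm_le t.2.1
      (Filter.Eventually.of_forall hbound)
      ((by fun_prop : Continuous fun s : ℝ =>
        M ^ (n + 1) / n.factorial * dist v w * s ^ n).intervalIntegrable _ _)).trans_eq ?_
    rw [intervalIntegral.integral_const_mul, integral_pow, Nat.factorial_succ]
    push_cast
    have : (n.factorial : ℝ) ≠ 0 := by positivity
    have : (n : ℝ) + 1 ≠ 0 := by positivity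
    field_simp
    simp

theorem exists_contractingWith_iterate_volterraOperator {T : ℝ} (hT : 0 ≤ T)
    {K : ℝ → ℝ → X →L[ℝ] X} (hK : Continuous fun p : ℝ × ℝ => K p.1 p.2)
    (u : C(Set.Icc 0 T, X)) :
    ∃ (n : ℕ) (c : NNReal), ContractingWith c (volterraOperator hT hK u)^[n] := by
  obtain ⟨M, hM⟩ := (isCompact_Icc.prod isCompact_Icc :
    IsCompact (Set.Icc 0 T ×ˢ Set.Icc 0 T)).exists_bound_of_continuousOn hK.continuousOn
  have hM' : ∀ t ∈ Set.Icc 0 T, ∀ s ∈ Set.Icc 0 T, ‖K t s‖ ≤ M :=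
    fun t ht s hs => hM (t, s) ⟨ht, hs⟩
  have hM0 : 0 ≤ M :=
    (norm_nonneg _).trans (hM' 0 (Set.left_mem_Icc.2 hT) 0 (Set.left_mem_Icc.2 hT))
  obtain ⟨n, hn⟩ := ((FloorSemiring.tendsto_pow_div_factorial_atTop (M * T)).eventually_lt_const
    one_pos).exists
  have hc : 0 ≤ (M * T) ^ n / n.factorial := by positivity
  refine ⟨n, ⟨_, hc⟩, hn, LipschitzWith.of_dist_le_mul fun v w => ?_⟩
  refine (ContinuousMap.dist_le (mul_nonneg hc dist_nonneg)).2 fun t => ?_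
  rw [dist_eq_norm]
  refine (norm_iterate_volterraOperator_sub_le hT hK u v w hM' n t).trans ?_
  rw [mul_pow]
  have := t.2.1
  have := t.2.2
  gcongr

theorem existsUnique_isFixedPt_volterraOperator [CompleteSpace X] {T : ℝ} (hT : 0 ≤ T)
    {K : ℝ → ℝ → X →L[ℝ] X} (hK : Continuous fun p : ℝ × ℝ => K p.1 p.2)
    (u : C(Set.Icc 0 T, X)) :
    ∃! w, Function.IsFixedPt (volterraOperator hT hK u) w := by
  obtain ⟨n, c, h⟩ := exists_contractingWith_iterate_volterraOperator hT hK u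
  exact ⟨_, h.isFixedPt_fixedPoint_iterate, fun v hv => h.fixedPoint_unique (hv.iterate n)⟩

end Volterra

theorem stmt8 {X : Type*} [NormedAddCommGroup X] [NormedSpace ℝ X] [CompleteSpace X]
    (T : ℝ) (hT : 0 < T) (u : ℝ → X) (hu : ContinuousOn u (Set.Icc 0 T))
    (k : ℝ → ℝ → X →L[ℝ] X)
    (hk : ContinuousOn (fun p : ℝ × ℝ => k p.1 p.2)
      {p : ℝ × ℝ | 0 ≤ p.2 ∧ p.2 ≤ p.1 ∧ p.1 ≤ T}) :
    ∃ w : ℝ → X,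
      (ContinuousOn w (Set.Icc 0 T) ∧
        ∀ t ∈ Set.Icc 0 T, w t = u t + ∫ s in (0:ℝ)..t, (k t s) (w s)) ∧
      ∀ w' : ℝ → X,
        (ContinuousOn w' (Set.Icc 0 T) ∧
          ∀ t ∈ Set.Icc 0 T, w' t = u t + ∫ s in (0:ℝ)..t, (k t s) (w' s)) →
        Set.EqOn w' w (Set.Icc 0 T) := by
  let K : ℝ → ℝ → X →L[ℝ] X := fun t s =>
    k (max 0 (min t T)) (max 0 (min s (max 0 (min t T))))
  have hK : Continuous fun p : ℝ × ℝ => K p.1 p.2 := by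
    refine hk.comp_continuous (f := fun p : ℝ × ℝ =>
      (max 0 (min p.1 T), max 0 (min p.2 (max 0 (min p.1 T))))) (by fun_prop) fun p => ?_
    exact ⟨le_max_left _ _, max_le (le_max_left _ _) (min_le_right _ _),
      max_le hT.le (min_le_right _ _)⟩
  have integral_eq (f : C(Set.Icc 0 T, X)) (g : ℝ → X) (hfg : ∀ s : Set.Icc 0 T, f s = g s)
      (t : ℝ) (ht : t ∈ Set.Icc 0 T) :
      ∫ s in (0 : ℝ)..t, K t s (f (Set.projIcc 0 T hT.le s)) =
        ∫ s in (0 : ℝ)..t, k t s (g s) := by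
    refine intervalIntegral.integral_congr fun s hs => ?_
    rw [Set.uIcc_of_le ht.1] at hs
    have hs' : s ∈ Set.Icc 0 T := ⟨hs.1, hs.2.trans ht.2⟩
    simp only [K, Set.projIcc_of_mem hT.le hs', hfg, min_eq_left ht.2, max_eq_right ht.1,
      min_eq_left hs.2, max_eq_right hs.1]
  obtain ⟨w, hw, huniq⟩ := existsUnique_isFixedPt_volterraOperator hT.le hK
    ⟨_, hu.domRestrict⟩
  have hext (s : Set.Icc 0 T) : w s = Set.IccExtend hT.le w s :=
    (Set.IccExtend_val hT.le w s).symm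
  refine ⟨Set.IccExtend hT.le w, ⟨w.continuous.Icc_extend'.continuousOn, fun t ht => ?_⟩, ?_⟩
  · rw [← integral_eq w _ hext t ht, ← hext ⟨t, ht⟩]
    exact (DFunLike.congr_fun hw ⟨t, ht⟩).symm
  · rintro w' ⟨hw', heq⟩ t ht
    have h : Function.IsFixedPt (volterraOperator hT.le hK ⟨_, hu.domRestrict⟩)
        ⟨_, hw'.domRestrict⟩ := by
      ext s
      refine Eq.trans ?_ (heq s s.2).symm
      exact congrArg (u s + ·) (integral_eq ⟨_, hw'.domRestrict⟩ w' (fun _ => rfl) s s.2)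
    rw [← hext ⟨t, ht⟩, ← huniq _ h]
    rfl
end

section
/- Let T > 0, K : [0,T] → ℝ continuous, μ ∈ ℝ, and let ζ : [0,T] → ℝ be the twice continuously differentiable solution of ζ''(t) = −μ·ζ(t) + ∫₀ᵗ K(t−s) ζ(s) ds with ζ(0)=0, ζ'(0)=1. Let h : [0,T] → ℝ be continuous and let w : [0,T] → ℝ be twice continuously differentiable with w(0)=0, w'(0)=0 and w''(t) = −μ·w(t) + ∫₀ᵗ K(t−s) w(s) ds + h(t) for all t ∈ [0,T]. Then w(t) = ∫₀ᵗ ζ(t−s) h(s) ds and w'(t) = ∫₀ᵗ ζ'(t−s) h(s) ds for every t ∈ [0,T]. -/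
open Set MeasureTheory

/-- The Volterra convolution `(f ∗ g)(t) = ∫₀ᵗ f(t-s) g(s) ds`. -/
noncomputable def volterraConv (f g : ℝ → ℝ) (t : ℝ) : ℝ := ∫ s in (0 : ℝ)..t, f (t - s) * g s

theorem volterraConv_comm (f g : ℝ → ℝ) (t : ℝ) : volterraConv f g t = volterraConv g f t := by
  have := intervalIntegral.integral_comp_sub_left (fun s => f s * g (t - s)) (a := 0) (b := t) t
  simp only [sub_sub_cancel, sub_self, sub_zero] at this
  simp only [volterraConv, this, mul_comm (g _)]

theorem volterraConv_congr {f₁ f₂ g₁ g₂ : ℝ → ℝ} {T t : ℝ} (ht : t ∈ Icc 0 T)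
    (hf : EqOn f₁ f₂ (Icc 0 T)) (hg : EqOn g₁ g₂ (Icc 0 T)) :
    volterraConv f₁ g₁ t = volterraConv f₂ g₂ t := by
  refine intervalIntegral.integral_congr fun s hs => ?_
  rw [uIcc_of_le ht.1] at hs
  simp only [hf ⟨sub_nonneg.2 hs.2, by linarith [hs.1, ht.2]⟩, hg ⟨hs.1, hs.2.trans ht.2⟩]

theorem continuousOn_comp_sub {f : ℝ → ℝ} {T t : ℝ} (ht : t ∈ Icc 0 T)
    (hf : ContinuousOn f (Icc 0 T)) : ContinuousOn (fun s => f (t - s)) (Icc 0 t) :=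
  hf.comp (by fun_prop) fun s hs => ⟨sub_nonneg.2 hs.2, by linarith [hs.1, ht.2]⟩

theorem intervalIntegrable_volterraConv {f g : ℝ → ℝ} {T t : ℝ} (ht : t ∈ Icc 0 T)
    (hf : ContinuousOn f (Icc 0 T)) (hg : ContinuousOn g (Icc 0 T)) :
    IntervalIntegrable (fun s => f (t - s) * g s) volume 0 t :=
  ((continuousOn_comp_sub ht hf).mul
    (hg.mono (Icc_subset_Icc_right ht.2))).intervalIntegrable_of_Icc ht.1

theorem volterraConv_add_right {f g₁ g₂ : ℝ → ℝ} {T t : ℝ} (ht : t ∈ Icc 0 T)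
    (hf : ContinuousOn f (Icc 0 T)) (hg₁ : ContinuousOn g₁ (Icc 0 T))
    (hg₂ : ContinuousOn g₂ (Icc 0 T)) :
    volterraConv f (fun s => g₁ s + g₂ s) t = volterraConv f g₁ t + volterraConv f g₂ t := by
  simp only [volterraConv, mul_add]
  exact intervalIntegral.integral_add (intervalIntegrable_volterraConv ht hf hg₁)
    (intervalIntegrable_volterraConv ht hf hg₂)

theorem volterraConv_const_mul_right (f g : ℝ → ℝ) (c t : ℝ) :
    volterraConv f (fun s => c * g s) t = c * volterraConv f g t := by
  simp only [volterraConv, ← intervalIntegral.integral_const_mul]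
  congr 1 with s
  ring

/-- Fubini's theorem on the triangle `0 ≤ r ≤ s ≤ t`. -/
theorem integral_integral_triangle_swap {F : ℝ → ℝ → ℝ} (hF : Continuous (Function.uncurry F))
    {t : ℝ} (ht : 0 ≤ t) :
    ∫ s in (0 : ℝ)..t, ∫ r in (0 : ℝ)..s, F s r = ∫ r in (0 : ℝ)..t, ∫ s in r..t, F s r := by
  let G : ℝ → ℝ → ℝ := fun s r => {p : ℝ × ℝ | p.2 < p.1}.indicator (Function.uncurry F) (s, r)
  have hG : Integrable (Function.uncurry G)
      ((volume.restrict (Ioc 0 t)).prod (volume.restrict (Ioc 0 t))) := by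
    rw [Measure.prod_restrict]
    have : IntegrableOn (Function.uncurry F) (Ioc 0 t ×ˢ Ioc 0 t) (volume.prod volume) :=
      (hF.continuousOn.integrableOn_compact (isCompact_Icc.prod isCompact_Icc)).mono_set
        (prod_mono Ioc_subset_Icc_self Ioc_subset_Icc_self)
    exact Integrable.indicator this (measurableSet_lt measurable_snd measurable_fst)
  rw [intervalIntegral.integral_of_le ht, intervalIntegral.integral_of_le ht]
  calc ∫ s in Ioc 0 t, ∫ r in (0 : ℝ)..s, F s r
      = ∫ s in Ioc 0 t, ∫ r in Ioc 0 t, G s r := by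
        refine setIntegral_congr_fun measurableSet_Ioc fun s hs => ?_
        have : G s = (Iio s).indicator (F s) := by
          ext r
          simp [G, indicator_apply]
        simp only [this]
        rw [setIntegral_indicator measurableSet_Iio, intervalIntegral.integral_of_le hs.1.le,
          integral_Ioc_eq_integral_Ioo]
        congr 2
        ext r
        simp only [mem_Ioo, mem_inter_iff, mem_Ioc, mem_Iio]
        exact ⟨fun h => ⟨⟨h.1, h.2.le.trans hs.2⟩, h.2⟩, fun h => ⟨h.1.1, h.2⟩⟩
    _ = ∫ r in Ioc 0 t, ∫ s in Ioc 0 t, G s r := integral_integral_swap hG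
    _ = ∫ r in Ioc 0 t, ∫ s in r..t, F s r := by
        refine setIntegral_congr_fun measurableSet_Ioc fun r hr => ?_
        have : (fun s => G s r) = (Ioi r).indicator (fun s => F s r) := by
          ext s
          simp [G, indicator_apply]
        simp only [this]
        rw [setIntegral_indicator measurableSet_Ioi, intervalIntegral.integral_of_le hr.2]
        congr 2
        ext s
        simp only [mem_inter_iff, mem_Ioc, mem_Ioi]
        exact ⟨fun h => ⟨h.2, h.1.2⟩, fun h => ⟨⟨hr.1.trans h.1, h.2⟩, h.1⟩⟩

theorem volterraConv_assoc_of_continuous {f g k : ℝ → ℝ} (hf : Continuous f) (hg : Continuous g)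
    (hk : Continuous k) {t : ℝ} (ht : 0 ≤ t) :
    volterraConv f (volterraConv g k) t = volterraConv (volterraConv f g) k t := by
  simp only [volterraConv, ← intervalIntegral.integral_const_mul,
    ← intervalIntegral.integral_mul_const]
  rw [integral_integral_triangle_swap (F := fun s r => f (t - s) * (g (s - r) * k r))
    (by unfold Function.uncurry; fun_prop) ht]
  congr 1 with r
  have := intervalIntegral.integral_comp_sub_right (fun u => f (t - r - u) * g u * k r)
    (a := r) (b := t) r
  rw [sub_self] at this
  rw [← this]
  congr 1 with s
  rw [sub_sub_sub_cancel_right, mul_assoc]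

theorem volterraConv_assoc {f g k : ℝ → ℝ} {T t : ℝ} (hf : ContinuousOn f (Icc 0 T))
    (hg : ContinuousOn g (Icc 0 T)) (hk : ContinuousOn k (Icc 0 T)) (ht : t ∈ Icc 0 T) :
    volterraConv f (volterraConv g k) t = volterraConv (volterraConv f g) k t := by
  have hT : 0 ≤ T := ht.1.trans ht.2
  have ext_cont {φ : ℝ → ℝ} (hφ : ContinuousOn φ (Icc 0 T)) :
      ∃ ψ : ℝ → ℝ, Continuous ψ ∧ EqOn φ ψ (Icc 0 T) :=
    ⟨IccExtend hT ((Icc 0 T).domRestrict φ), hφ.domRestrict.Icc_extend',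
      fun x hx => by rw [IccExtend_of_mem hT _ hx, domRestrict_apply]⟩
  obtain ⟨f', hf', hff⟩ := ext_cont hf
  obtain ⟨g', hg', hgg⟩ := ext_cont hg
  obtain ⟨k', hk', hkk⟩ := ext_cont hk
  rw [volterraConv_congr ht hff fun s hs => volterraConv_congr hs hgg hkk,
    volterraConv_assoc_of_continuous hf' hg' hk' ht.1]
  exact (volterraConv_congr ht (fun s hs => volterraConv_congr hs hff hgg) hkk).symm

/-- Integration by parts: `u ∗ v' - u' ∗ v = u(0) v - v(0) u`. -/
theorem volterraConv_deriv_sub_deriv {u u' v v' : ℝ → ℝ} {T t : ℝ} (ht : t ∈ Icc 0 T)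
    (hu : ∀ x ∈ Icc 0 T, HasDerivWithinAt u (u' x) (Icc 0 T) x)
    (hv : ∀ x ∈ Icc 0 T, HasDerivWithinAt v (v' x) (Icc 0 T) x)
    (hu' : ContinuousOn u' (Icc 0 T)) (hv' : ContinuousOn v' (Icc 0 T)) :
    volterraConv u v' t - volterraConv u' v t = u 0 * v t - u t * v 0 := by
  have cu : ContinuousOn u (Icc 0 T) := fun x hx => (hu x hx).continuousWithinAt
  have cv : ContinuousOn v (Icc 0 T) := fun x hx => (hv x hx).continuousWithinAt
  have i₁ := intervalIntegrable_volterraConv ht cu hv'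
  have i₂ := intervalIntegrable_volterraConv ht hu' cv
  have := intervalIntegral.integral_eq_sub_of_hasDerivAt_of_le ht.1
    ((continuousOn_comp_sub ht cu).mul (cv.mono (Icc_subset_Icc_right ht.2)))
    (f' := fun s => u (t - s) * v' s - u' (t - s) * v s) (fun s hs => ?_) (i₁.sub i₂)
  · rw [intervalIntegral.integral_sub i₁ i₂] at this
    simpa [volterraConv] using this
  · have ds : t - s ∈ Ioo 0 T := ⟨sub_pos.2 hs.2, by linarith [hs.1, ht.2]⟩
    have ss : s ∈ Ioo 0 T := ⟨hs.1, hs.2.trans_le ht.2⟩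
    have du := ((hu _ (Ioo_subset_Icc_self ds)).hasDerivAt (Icc_mem_nhds ds.1 ds.2)).comp s
      ((hasDerivAt_id s).const_sub t)
    have dv := (hv _ (Ioo_subset_Icc_self ss)).hasDerivAt (Icc_mem_nhds ss.1 ss.2)
    refine (du.mul dv).congr_deriv ?_
    simp only [Function.comp_apply]
    ring

theorem stmt10 (T : ℝ) (hT : 0 < T) (K : ℝ → ℝ) (hK : ContinuousOn K (Set.Icc 0 T)) (μ : ℝ)
    (ζ ζd ζdd : ℝ → ℝ)
    (hζ1 : ∀ t ∈ Set.Icc 0 T, HasDerivWithinAt ζ (ζd t) (Set.Icc 0 T) t)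
    (hζ2 : ∀ t ∈ Set.Icc 0 T, HasDerivWithinAt ζd (ζdd t) (Set.Icc 0 T) t)
    (hζ3 : ContinuousOn ζdd (Set.Icc 0 T))
    (hζ0 : ζ 0 = 0) (hζd0 : ζd 0 = 1)
    (hζeq : ∀ t ∈ Set.Icc 0 T, ζdd t = -μ * ζ t + ∫ s in (0:ℝ)..t, K (t - s) * ζ s)
    (h : ℝ → ℝ) (hh : ContinuousOn h (Set.Icc 0 T))
    (w wd wdd : ℝ → ℝ)
    (hw1 : ∀ t ∈ Set.Icc 0 T, HasDerivWithinAt w (wd t) (Set.Icc 0 T) t)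
    (hw2 : ∀ t ∈ Set.Icc 0 T, HasDerivWithinAt wd (wdd t) (Set.Icc 0 T) t)
    (hw3 : ContinuousOn wdd (Set.Icc 0 T))
    (hw0 : w 0 = 0) (hwd0 : wd 0 = 0)
    (hweq : ∀ t ∈ Set.Icc 0 T,
      wdd t = -μ * w t + (∫ s in (0:ℝ)..t, K (t - s) * w s) + h t) :
    ∀ t ∈ Set.Icc 0 T,
      w t = (∫ s in (0:ℝ)..t, ζ (t - s) * h s) ∧
      wd t = ∫ s in (0:ℝ)..t, ζd (t - s) * h s := by
  have cζd : ContinuousOn ζd (Icc 0 T) := fun x hx => (hζ2 x hx).continuousWithinAt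
  have cζ : ContinuousOn ζ (Icc 0 T) := fun x hx => (hζ1 x hx).continuousWithinAt
  have cwd : ContinuousOn wd (Icc 0 T) := fun x hx => (hw2 x hx).continuousWithinAt
  have cw : ContinuousOn w (Icc 0 T) := fun x hx => (hw1 x hx).continuousWithinAt
  have eζ : EqOn ζdd (fun s => -μ * ζ s + volterraConv K ζ s) (Icc 0 T) := hζeq
  have ew : EqOn wdd (fun s => -μ * w s + volterraConv K w s + h s) (Icc 0 T) := hweq
  have cμζ : ContinuousOn (fun s => -μ * ζ s) (Icc 0 T) := by fun_prop
  have cμw : ContinuousOn (fun s => -μ * w s) (Icc 0 T) := by fun_prop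
  have cKζ : ContinuousOn (volterraConv K ζ) (Icc 0 T) :=
    (hζ3.sub cμζ).congr fun s hs => by simp [eζ hs]
  have cKw : ContinuousOn (volterraConv K w) (Icc 0 T) :=
    ((hw3.sub cμw).sub hh).congr fun s hs => by simp [ew hs]; ring
  have conv_wdd {f : ℝ → ℝ} (hf : ContinuousOn f (Icc 0 T)) {t : ℝ} (ht : t ∈ Icc 0 T) :
      volterraConv f wdd t = -μ * volterraConv f w t + volterraConv f (volterraConv K w) t
        + volterraConv f h t := by
    rw [volterraConv_congr ht (fun _ _ => rfl) ew,
      volterraConv_add_right ht hf (cμw.fun_add cKw) hh, volterraConv_add_right ht hf cμw cKw,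
      volterraConv_const_mul_right]
  have conv_ζdd {f : ℝ → ℝ} (hf : ContinuousOn f (Icc 0 T)) {t : ℝ} (ht : t ∈ Icc 0 T) :
      volterraConv ζdd f t = -μ * volterraConv ζ f t + volterraConv ζ (volterraConv K f) t := by
    rw [volterraConv_comm, volterraConv_congr ht (fun _ _ => rfl) eζ,
      volterraConv_add_right ht hf cμζ cKζ, volterraConv_const_mul_right,
      volterraConv_comm f ζ, volterraConv_comm f, volterraConv_assoc cζ hK hf ht]
    simp only [funext (volterraConv_comm K ζ)]
  have conv_ζd_w {t : ℝ} (ht : t ∈ Icc 0 T) : volterraConv ζd w t = volterraConv ζ wd t := by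
    have := volterraConv_deriv_sub_deriv ht hζ1 hw1 cζd cwd
    rw [hζ0, hw0] at this
    linarith
  intro t ht
  have e₁ := volterraConv_deriv_sub_deriv ht hζ1 hw2 cζd hw3
  have e₂ := volterraConv_deriv_sub_deriv ht hζ2 hw1 hζ3 cwd
  have e₃ := volterraConv_deriv_sub_deriv ht hζ2 hw2 hζ3 hw3
  rw [hζ0, hwd0] at e₁
  rw [hζd0, hw0] at e₂
  rw [hζd0, hwd0] at e₃
  have memory : volterraConv ζd (volterraConv K w) t = volterraConv ζ (volterraConv K wd) t := by
    rw [funext (volterraConv_comm K w), funext (volterraConv_comm K wd),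
      volterraConv_assoc cζd cw hK ht, volterraConv_assoc cζ cwd hK ht]
    exact volterraConv_congr ht (fun s hs => conv_ζd_w hs) fun _ _ => rfl
  change w t = volterraConv ζ h t ∧ wd t = volterraConv ζd h t
  constructor
  · linarith [conv_wdd cζ ht, conv_ζdd cw ht]
  · have hμ : μ * volterraConv ζd w t = μ * volterraConv ζ wd t := by rw [conv_ζd_w ht]
    linarith [conv_wdd cζd ht, conv_ζdd cwd ht]
end

section
/- Let T > 0, K : [0,T] → ℝ continuous, λ > 0, and let ζ : [0,T] → ℝ be the twice continuously differentiable solution of ζ''(t) = −λ²·ζ(t) + ∫₀ᵗ K(t−s) ζ(s) ds with ζ(0)=0, ζ'(0)=1. Define Q(s) = ∫₀ˢ K(s−τ) sin(λτ) dτ. Then for every t ∈ [0,T]: ζ(t) = sin(λt)/λ + (1/λ) ∫₀ᵗ Q(t−s) ζ(s) ds. -/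
open MeasureTheory Set in
/-- Fubini's theorem on the triangle `a ≤ u ≤ s ≤ b` for a continuous integrand. -/
theorem intervalIntegral_triangle_swap {f : ℝ → ℝ → ℝ} (hf : Continuous f.uncurry) {a b : ℝ}
    (hab : a ≤ b) :
    ∫ s in a..b, ∫ u in a..s, f s u = ∫ u in a..b, ∫ s in u..b, f s u := by
  set D : Set (ℝ × ℝ) := {p | p.2 < p.1} with hD
  have hDm : MeasurableSet D := measurableSet_lt measurable_snd measurable_fst
  have hint : IntegrableOn (Function.uncurry fun s u => D.indicator f.uncurry (s, u))
      (uIoc a b ×ˢ uIoc a b) := by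
    refine IntegrableOn.indicator ?_ hDm
    refine (hf.continuousOn.integrableOn_compact
      (isCompact_uIcc (a := a) (b := b) |>.prod (isCompact_uIcc (a := a) (b := b)))).mono_set ?_
    exact prod_mono uIoc_subset_uIcc uIoc_subset_uIcc
  calc
    _ = ∫ s in a..b, ∫ u in a..b, D.indicator f.uncurry (s, u) := by
      refine intervalIntegral.integral_congr fun s hs => ?_
      rw [uIcc_of_le hab] at hs
      have : (fun u => D.indicator f.uncurry (s, u)) = (Iio s).indicator (f s) := by
        ext u; simp [indicator, hD]
      simp only [this]
      rw [intervalIntegral.integral_of_le hs.1, intervalIntegral.integral_of_le hab,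
        setIntegral_indicator measurableSet_Iio, integral_Ioc_eq_integral_Ioo]
      congr 2
      ext u
      simp only [mem_Ioo, mem_inter_iff, mem_Ioc, mem_Iio]
      grind
    _ = ∫ u in a..b, ∫ s in a..b, D.indicator f.uncurry (s, u) :=
      intervalIntegral_intervalIntegral_swap hint
    _ = _ := by
      refine intervalIntegral.integral_congr fun u hu => ?_
      rw [uIcc_of_le hab] at hu
      have : (fun s => D.indicator f.uncurry (s, u)) = (Ioi u).indicator (fun s => f s u) := by
        ext s; simp [indicator, hD]
      simp only [this]
      rw [intervalIntegral.integral_of_le hu.2, intervalIntegral.integral_of_le hab,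
        setIntegral_indicator measurableSet_Ioi]
      congr 2
      ext s
      simp only [mem_inter_iff, mem_Ioc, mem_Ioi]
      grind

/-- Associativity of the convolution product `(F ∗ G) t = ∫ s in 0..t, F (t - s) * G s`. -/
theorem intervalIntegral_convolution_assoc {S K z : ℝ → ℝ} (hS : Continuous S) (hK : Continuous K)
    (hz : Continuous z) {t : ℝ} (ht : 0 ≤ t) :
    ∫ s in (0 : ℝ)..t, S (t - s) * ∫ u in (0 : ℝ)..s, K (s - u) * z u =
      ∫ s in (0 : ℝ)..t, (∫ τ in (0 : ℝ)..(t - s), K (t - s - τ) * S τ) * z s := by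
  simp only [← intervalIntegral.integral_const_mul, ← intervalIntegral.integral_mul_const]
  rw [intervalIntegral_triangle_swap (f := fun s u => S (t - s) * (K (s - u) * z u))
    (by simp only [Function.uncurry_def]; fun_prop) ht]
  refine intervalIntegral.integral_congr fun u _ => ?_
  have h := intervalIntegral.integral_comp_sub_left (a := 0) (b := t - u)
    (fun s => S (t - s) * (K (s - u) * z u)) t
  simp only [sub_zero, sub_sub_cancel] at h
  simp only [← h]
  refine intervalIntegral.integral_congr fun τ _ => ?_
  simp only [sub_right_comm t τ u]
  ring

/-- Duhamel formula for the oscillator: `zdd + lam ^ 2 * z` is the forcing term, `zd` and `zdd` being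
the first and second derivatives of `z`. -/
theorem integral_sin_mul_forcing {z zd zdd : ℝ → ℝ} {t lam : ℝ} (ht : 0 ≤ t)
    (hz : ∀ s ∈ Set.Icc 0 t, HasDerivWithinAt z (zd s) (Set.Icc 0 t) s)
    (hzd : ∀ s ∈ Set.Icc 0 t, HasDerivWithinAt zd (zdd s) (Set.Icc 0 t) s)
    (hzdd : ContinuousOn zdd (Set.Icc 0 t)) :
    ∫ s in (0 : ℝ)..t, Real.sin (lam * (t - s)) * (zdd s + lam ^ 2 * z s) =
      lam * z t - (Real.sin (lam * t) * zd 0 + lam * (Real.cos (lam * t) * z 0)) := by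
  have hzc : ContinuousOn z (Set.Icc 0 t) := fun s hs => (hz s hs).continuousWithinAt
  have hG : ∀ s ∈ Set.Icc 0 t, HasDerivWithinAt
      (fun s => Real.sin (lam * (t - s)) * zd s + lam * (Real.cos (lam * (t - s)) * z s))
      (Real.sin (lam * (t - s)) * (zdd s + lam ^ 2 * z s)) (Set.Icc 0 t) s := by
    intro s hs
    have hl : HasDerivWithinAt (fun s => lam * (t - s)) (lam * -1) (Set.Icc 0 t) s :=
      ((hasDerivWithinAt_id s _).const_sub t).const_mul lam
    refine ((hl.sin.mul (hzd s hs)).add ((hl.cos.mul (hz s hs)).const_mul lam)).congr_deriv ?_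
    ring
  rw [intervalIntegral.integral_eq_sub_of_hasDerivAt_of_le ht
    (fun s hs => (hG s hs).continuousWithinAt)
    (fun s hs => (hG s (Set.Ioo_subset_Icc_self hs)).hasDerivAt (Icc_mem_nhds hs.1 hs.2))]
  · simp
  · refine ContinuousOn.intervalIntegrable ?_
    rw [Set.uIcc_of_le ht]
    fun_prop

theorem stmt11 (T : ℝ) (hT : 0 < T) (K : ℝ → ℝ) (hK : ContinuousOn K (Set.Icc 0 T))
    (lam : ℝ) (hlam : 0 < lam)
    (ζ ζd ζdd : ℝ → ℝ)
    (hζ1 : ∀ t ∈ Set.Icc 0 T, HasDerivWithinAt ζ (ζd t) (Set.Icc 0 T) t)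
    (hζ2 : ∀ t ∈ Set.Icc 0 T, HasDerivWithinAt ζd (ζdd t) (Set.Icc 0 T) t)
    (hζ3 : ContinuousOn ζdd (Set.Icc 0 T))
    (hζ0 : ζ 0 = 0) (hζd0 : ζd 0 = 1)
    (hζeq : ∀ t ∈ Set.Icc 0 T,
      ζdd t = -lam ^ 2 * ζ t + ∫ s in (0:ℝ)..t, K (t - s) * ζ s)
    (Q : ℝ → ℝ)
    (hQ : ∀ s, Q s = ∫ τ in (0:ℝ)..s, K (s - τ) * Real.sin (lam * τ)) :
    ∀ t ∈ Set.Icc 0 T,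
      ζ t = Real.sin (lam * t) / lam + (1 / lam) * ∫ s in (0:ℝ)..t, Q (t - s) * ζ s := by
  intro t ht
  have hsub : Set.Icc 0 t ⊆ Set.Icc 0 T := Set.Icc_subset_Icc_right ht.2
  have hζc : ContinuousOn ζ (Set.Icc 0 T) := fun s hs => (hζ1 s hs).continuousWithinAt
  set k : ℝ → ℝ := Set.IccExtend hT.le ((Set.Icc 0 T).domRestrict K)
  set z : ℝ → ℝ := Set.IccExtend hT.le ((Set.Icc 0 T).domRestrict ζ)
  have hk : Continuous k := hK.domRestrict.Icc_extend'
  have hz : Continuous z := hζc.domRestrict.Icc_extend'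
  have hkK : ∀ s ∈ Set.Icc 0 T, k s = K s := fun s hs => Set.IccExtend_of_mem _ _ hs
  have hzζ : ∀ s ∈ Set.Icc 0 T, z s = ζ s := fun s hs => Set.IccExtend_of_mem _ _ hs
  have hduhamel := integral_sin_mul_forcing (lam := lam) ht.1
    (fun s hs => (hζ1 s (hsub hs)).mono hsub) (fun s hs => (hζ2 s (hsub hs)).mono hsub)
    (hζ3.mono hsub)
  have hassoc := intervalIntegral_convolution_assoc
    (S := fun s => Real.sin (lam * s)) (by fun_prop) hk hz ht.1
  have hforcing : ∫ s in (0 : ℝ)..t, Real.sin (lam * (t - s)) * (ζdd s + lam ^ 2 * ζ s) =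
      ∫ s in (0 : ℝ)..t, Real.sin (lam * (t - s)) * ∫ u in (0 : ℝ)..s, k (s - u) * z u := by
    refine intervalIntegral.integral_congr fun s hs => ?_
    rw [Set.uIcc_of_le ht.1] at hs
    have : ∫ u in (0 : ℝ)..s, k (s - u) * z u = ∫ u in (0 : ℝ)..s, K (s - u) * ζ u := by
      refine intervalIntegral.integral_congr fun u hu => ?_
      rw [Set.uIcc_of_le hs.1] at hu
      simp only [hkK (s - u) ⟨by linarith [hu.2], by linarith [hu.1, hs.2, ht.2]⟩,
        hzζ u ⟨hu.1, by linarith [hu.2, hs.2, ht.2]⟩]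
    simp only [this, hζeq s (hsub hs)]
    ring
  have hQζ : ∫ s in (0 : ℝ)..t,
      (∫ τ in (0 : ℝ)..(t - s), k (t - s - τ) * Real.sin (lam * τ)) * z s =
      ∫ s in (0 : ℝ)..t, Q (t - s) * ζ s := by
    refine intervalIntegral.integral_congr fun s hs => ?_
    rw [Set.uIcc_of_le ht.1] at hs
    simp only [hQ, hzζ s (hsub hs)]
    congr 1
    refine intervalIntegral.integral_congr fun τ hτ => ?_
    rw [Set.uIcc_of_le (by linarith [hs.2])] at hτ
    simp only [hkK (t - s - τ) ⟨by linarith [hτ.2], by linarith [hτ.1, hs.1, ht.2]⟩]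
  rw [← hQζ, ← hassoc, ← hforcing, hduhamel, hζ0, hζd0]
  field_simp
  ring
end

section
/- Let T > 0, K : [0,T] → ℝ continuous, λ > 0, and let ζ : [0,T] → ℝ be the twice continuously differentiable solution of ζ''(t) = −λ²·ζ(t) + ∫₀ᵗ K(t−s) ζ(s) ds with ζ(0)=0, ζ'(0)=1. Define Q(s) = ∫₀ˢ K(s−τ) sin(λτ) dτ. Then for every t ∈ [0,T]: ζ'(t) = cos(λt) + (1/λ) ∫₀ᵗ Q(t−s) ζ'(s) ds. -/
open MeasureTheory intervalIntegral Set in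
theorem integral_triangle_swap {f : ℝ → ℝ → ℝ} (hf : Continuous f.uncurry) {t : ℝ}
    (ht : 0 ≤ t) :
    ∫ s in (0:ℝ)..t, ∫ u in (0:ℝ)..s, f s u = ∫ u in (0:ℝ)..t, ∫ s in u..t, f s u := by
  have hm : MeasurableSet {p : ℝ × ℝ | p.2 < p.1} := measurableSet_lt measurable_snd measurable_fst
  have hswap := intervalIntegral_intervalIntegral_swap (a := 0) (b := t) (c := 0) (d := t)
    (F := fun s u => {p : ℝ × ℝ | p.2 < p.1}.indicator f.uncurry (s, u)) (by
      rw [uIoc_of_le ht]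
      refine Integrable.indicator ?_ hm
      exact (hf.continuousOn.integrableOn_compact (isCompact_Icc.prod isCompact_Icc)).mono_set
        (prod_mono Ioc_subset_Icc_self Ioc_subset_Icc_self))
  calc _ = ∫ s in (0:ℝ)..t, ∫ u in (0:ℝ)..t,
        {p : ℝ × ℝ | p.2 < p.1}.indicator f.uncurry (s, u) := by
        refine integral_congr fun s hs => ?_
        rw [uIcc_of_le ht] at hs
        have hset : Ioc 0 t ∩ Iio s = Ioo 0 s := by
          ext u; simp only [mem_inter_iff, mem_Ioc, mem_Iio, mem_Ioo]
          have := hs.2; grind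
        calc _ = ∫ u in Ioc 0 t, (Iio s).indicator (f s) u := by
              rw [setIntegral_indicator measurableSet_Iio, hset, ← integral_Ioc_eq_integral_Ioo,
                integral_of_le hs.1]
          _ = _ := by rw [integral_of_le ht]; rfl
    _ = _ := hswap
    _ = _ := by
        refine integral_congr fun u hu => ?_
        rw [uIcc_of_le ht] at hu
        have hset : Ioc 0 t ∩ Ioi u = Ioc u t := by
          ext s; simp only [mem_inter_iff, mem_Ioc, mem_Ioi]
          have := hu.1; grind
        calc _ = ∫ s in Ioc 0 t, (Ioi u).indicator (fun s => f s u) s := by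
              rw [integral_of_le ht]; rfl
          _ = _ := by
              rw [setIntegral_indicator measurableSet_Ioi, hset, integral_of_le hu.2]

/-- The convolution of two functions on `[0, t]`. -/
noncomputable def causalConv (f g : ℝ → ℝ) (t : ℝ) : ℝ := ∫ s in (0:ℝ)..t, f (t - s) * g s

theorem causalConv_comm (f g : ℝ → ℝ) : causalConv f g = causalConv g f := by
  funext t
  have h := intervalIntegral.integral_comp_sub_left (fun s => f s * g (t - s)) (a := 0) (b := t) t
  simpa [causalConv, mul_comm] using h

theorem causalConv_assoc {f g h : ℝ → ℝ} (hf : Continuous f) (hg : Continuous g)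
    (hh : Continuous h) {t : ℝ} (ht : 0 ≤ t) :
    causalConv (causalConv f g) h t = causalConv f (causalConv g h) t := by
  have hcont : Continuous (Function.uncurry fun s u => f (t - s) * (g (s - u) * h u)) := by
    unfold Function.uncurry
    fun_prop
  simp only [causalConv]
  simp_rw [← intervalIntegral.integral_const_mul]
  rw [integral_triangle_swap hcont ht]
  refine intervalIntegral.integral_congr fun u _ => ?_
  have hsub := intervalIntegral.integral_comp_sub_right
    (fun s => f (t - u - s) * g s) (a := u) (b := t) u
  simp only [sub_self] at hsub
  simp only [← hsub, ← intervalIntegral.integral_mul_const]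
  refine intervalIntegral.integral_congr fun s _ => ?_
  simp only [sub_sub_sub_cancel_right]
  ring

theorem causalConv_congr {f f' g g' : ℝ → ℝ} {T t : ℝ} (hf : Set.EqOn f f' (Set.Icc 0 T))
    (hg : Set.EqOn g g' (Set.Icc 0 T)) (ht : t ∈ Set.Icc 0 T) :
    causalConv f g t = causalConv f' g' t := by
  refine intervalIntegral.integral_congr fun s hs => ?_
  rw [Set.uIcc_of_le ht.1] at hs
  have hts := ht.2
  have hs1 := hs.1
  have hs2 := hs.2
  simp only [hf (show t - s ∈ Set.Icc 0 T from ⟨by linarith, by linarith⟩),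
    hg (show s ∈ Set.Icc 0 T from ⟨by linarith, by linarith⟩)]

theorem causalConv_sin_deriv {T lam : ℝ} {z zd : ℝ → ℝ}
    (hz : ∀ t ∈ Set.Icc 0 T, HasDerivWithinAt z (zd t) (Set.Icc 0 T) t)
    (hzd : ContinuousOn zd (Set.Icc 0 T)) (hz0 : z 0 = 0) {t : ℝ} (ht : t ∈ Set.Icc 0 T) :
    causalConv (fun s => Real.sin (lam * s)) zd t =
      lam * causalConv (fun s => Real.cos (lam * s)) z t := by
  have hsub : Set.uIcc 0 t ⊆ Set.Icc 0 T := by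
    rw [Set.uIcc_of_le ht.1]; exact Set.Icc_subset_Icc_right ht.2
  have hu : ∀ s ∈ Set.uIcc 0 t, HasDerivWithinAt (fun s => Real.sin (lam * (t - s)))
      (-(lam * Real.cos (lam * (t - s)))) (Set.uIcc 0 t) s := by
    intro s _
    have := ((((hasDerivAt_id s).const_sub t).const_mul lam).sin).hasDerivWithinAt
      (s := Set.uIcc 0 t)
    simp only [id] at this
    exact this.congr_deriv (by ring)
  have hparts := intervalIntegral.integral_mul_deriv_eq_deriv_mul_of_hasDerivWithinAt hu
    (fun s hs => (hz s (hsub hs)).mono hsub)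
    (Continuous.intervalIntegrable (by fun_prop) _ _) ((hzd.mono hsub).intervalIntegrable)
  simp only [causalConv]
  rw [hparts, ← intervalIntegral.integral_const_mul]
  simp [hz0, mul_assoc]

theorem oscillator_duhamel_deriv {T lam : ℝ} {z zd zdd F : ℝ → ℝ}
    (hz : ∀ t ∈ Set.Icc 0 T, HasDerivWithinAt z (zd t) (Set.Icc 0 T) t)
    (hzd : ∀ t ∈ Set.Icc 0 T, HasDerivWithinAt zd (zdd t) (Set.Icc 0 T) t)
    (hzdd : ContinuousOn zdd (Set.Icc 0 T))
    (heq : ∀ t ∈ Set.Icc 0 T, zdd t = -lam ^ 2 * z t + F t)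
    (hz0 : z 0 = 0) (hzd0 : zd 0 = 1) {t : ℝ} (ht : t ∈ Set.Icc 0 T) :
    zd t = Real.cos (lam * t) + causalConv (fun s => Real.cos (lam * s)) F t := by
  have hsub : Set.Icc 0 t ⊆ Set.Icc 0 T := Set.Icc_subset_Icc_right ht.2
  have hF : ContinuousOn F (Set.Icc 0 t) := by
    have hzc : ContinuousOn z (Set.Icc 0 T) := fun s hs => (hz s hs).continuousWithinAt
    refine ((hzdd.add (hzc.const_smul (lam ^ 2))).mono hsub).congr fun s hs => ?_
    simp only [smul_eq_mul, Pi.add_apply, Pi.smul_apply]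
    rw [heq s (hsub hs)]
    ring
  have hderiv : ∀ s ∈ Set.Icc 0 t, HasDerivWithinAt
      (fun s => Real.cos (lam * (t - s)) * zd s - lam * (Real.sin (lam * (t - s)) * z s))
      (Real.cos (lam * (t - s)) * F s) (Set.Icc 0 t) s := by
    intro s hs
    have hlin : HasDerivAt (fun s => lam * (t - s)) (lam * -1) s :=
      ((hasDerivAt_id s).const_sub t).const_mul lam
    have := (hlin.cos.hasDerivWithinAt.mul ((hzd s (hsub hs)).mono hsub)).sub
      ((hlin.sin.hasDerivWithinAt.mul ((hz s (hsub hs)).mono hsub)).const_mul lam)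
    exact this.congr_deriv (by rw [heq s (hsub hs)]; ring)
  have hftc := intervalIntegral.integral_eq_sub_of_hasDerivAt_of_le ht.1
    (fun s hs => (hderiv s hs).continuousWithinAt)
    (fun s hs => (hderiv s (Set.Ioo_subset_Icc_self hs)).hasDerivAt (Icc_mem_nhds hs.1 hs.2))
    (ContinuousOn.intervalIntegrable (by rw [Set.uIcc_of_le ht.1]; fun_prop))
  simp only [causalConv]
  rw [hftc]
  simp [hz0, hzd0]

theorem stmt12 (T : ℝ) (hT : 0 < T) (K : ℝ → ℝ) (hK : ContinuousOn K (Set.Icc 0 T))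
    (lam : ℝ) (hlam : 0 < lam)
    (ζ ζd ζdd : ℝ → ℝ)
    (hζ1 : ∀ t ∈ Set.Icc 0 T, HasDerivWithinAt ζ (ζd t) (Set.Icc 0 T) t)
    (hζ2 : ∀ t ∈ Set.Icc 0 T, HasDerivWithinAt ζd (ζdd t) (Set.Icc 0 T) t)
    (hζ3 : ContinuousOn ζdd (Set.Icc 0 T))
    (hζ0 : ζ 0 = 0) (hζd0 : ζd 0 = 1)
    (hζeq : ∀ t ∈ Set.Icc 0 T,
      ζdd t = -lam ^ 2 * ζ t + ∫ s in (0:ℝ)..t, K (t - s) * ζ s)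
    (Q : ℝ → ℝ)
    (hQ : ∀ s, Q s = ∫ τ in (0:ℝ)..s, K (s - τ) * Real.sin (lam * τ)) :
    ∀ t ∈ Set.Icc 0 T,
      ζd t = Real.cos (lam * t) + (1 / lam) * ∫ s in (0:ℝ)..t, Q (t - s) * ζd s := by
  intro t ht
  let S : ℝ → ℝ := fun s => Real.sin (lam * s)
  let C : ℝ → ℝ := fun s => Real.cos (lam * s)
  have hS : Continuous S := by fun_prop
  have hC : Continuous C := by fun_prop
  have hζc : ContinuousOn ζ (Set.Icc 0 T) := fun s hs => (hζ1 s hs).continuousWithinAt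
  have hζdc : ContinuousOn ζd (Set.Icc 0 T) := fun s hs => (hζ2 s hs).continuousWithinAt
  have extend (f : ℝ → ℝ) (hf : ContinuousOn f (Set.Icc 0 T)) :
      ∃ g, Continuous g ∧ Set.EqOn f g (Set.Icc 0 T) :=
    ⟨Set.IccExtend hT.le (Set.domRestrict (Set.Icc 0 T) f), hf.domRestrict.Icc_extend',
      fun s hs => (Set.IccExtend_of_mem hT.le ((Set.Icc 0 T).domRestrict f) hs).symm⟩
  obtain ⟨K', hK', hKK'⟩ := extend K hK
  obtain ⟨z, hz, hζz⟩ := extend ζ hζc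
  obtain ⟨zd, hzd, hζzd⟩ := extend ζd hζdc
  have refl (f : ℝ → ℝ) : Set.EqOn f f (Set.Icc 0 T) := Set.eqOn_refl f _
  have hQS : Set.EqOn Q (causalConv K' S) (Set.Icc 0 T) := fun s hs =>
    (hQ s).trans (causalConv_congr hKK' (refl S) hs)
  have hparts : Set.EqOn (causalConv S zd) (fun s => lam * causalConv C z s) (Set.Icc 0 T) := by
    intro s hs
    beta_reduce
    rw [← causalConv_congr (refl S) hζzd hs, ← causalConv_congr (refl C) hζz hs]
    exact causalConv_sin_deriv hζ1 hζdc hζ0 hs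
  have hconv : causalConv Q ζd t = lam * causalConv C (causalConv K ζ) t :=
    calc causalConv Q ζd t = causalConv (causalConv K' S) zd t := causalConv_congr hQS hζzd ht
      _ = causalConv K' (causalConv S zd) t := causalConv_assoc hK' hS hzd ht.1
      _ = causalConv K' (fun s => lam * causalConv C z s) t :=
        causalConv_congr (refl K') hparts ht
      _ = lam * causalConv K' (causalConv C z) t := by
        simp only [causalConv, mul_left_comm _ lam, intervalIntegral.integral_const_mul]
      _ = lam * causalConv C (causalConv K' z) t := by
        rw [← causalConv_assoc hK' hC hz ht.1, causalConv_comm K' C,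
          causalConv_assoc hC hK' hz ht.1]
      _ = lam * causalConv C (causalConv K ζ) t := by
        rw [causalConv_congr (refl C) (fun s hs => causalConv_congr hKK' hζz hs) ht]
  rw [oscillator_duhamel_deriv (F := causalConv K ζ) hζ1 hζ2 hζ3 hζeq hζ0 hζd0 ht]
  change _ + causalConv C (causalConv K ζ) t = _ + 1 / lam * causalConv Q ζd t
  rw [hconv]
  field_simp
end
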